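/- Let g : X → ℝ be bounded, measurable and nonnegative, let δ > 0, and suppose that (Pg)(x) ≤ g(x) for every x ∈ {y : g(y) < δ}. Then for every x ∈ X, u(x; {g < δ}) ≥ 1 − g(x)/δ. -/

import Mathlib

open MeasureTheory ProbabilityTheory

variable {X : Type*} [MeasurableSpace X]

/-- Transition operator: `(Pf)(x) = ∫ f(y) P(x,dy)`. -/
noncomputable def transOp (P : Kernel X X) (f : X → ℝ) : X → ℝ :=
  fun x => ∫ y, f y ∂(P x)

/-- Invariance operator `I_A f = 1_A · (Pf)`. -/
noncomputable def invOp (P : Kernel X X) (A : Set X) (f : X → ℝ) : X → ℝ :=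
  A.indicator (transOp P f)

/-- Invariance value functions `u_n(·;A)`. -/
noncomputable def uN (P : Kernel X X) (A : Set X) : ℕ → X → ℝ
  | 0 => A.indicator 1
  | n + 1 => invOp P A (uN P A n)

/-- `u(x;A) = lim_n u_n(x;A)` (the sequence is pointwise nonincreasing). -/
noncomputable def uFun (P : Kernel X X) (A : Set X) : X → ℝ :=
  fun x => ⨅ n, uN P A n x

/-- Reach-avoid value functions `w_n(·;A,B)`. -/
noncomputable def wN (P : Kernel X X) (A B : Set X) : ℕ → X → ℝ
  | 0 => B.indicator 1
  | n + 1 => fun x => B.indicator 1 x + invOp P (A \ B) (wN P A B n) x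

/-- `w(x;A,B) = lim_n w_n(x;A,B)` (the sequence is pointwise nondecreasing, in `[0,1]`). -/
noncomputable def wFun (P : Kernel X X) (A B : Set X) : X → ℝ :=
  fun x => ⨆ n, wN P A B n x

/-- A bounded function. -/
def BddFun (f : X → ℝ) : Prop := ∃ C : ℝ, ∀ x, |f x| ≤ C

/-- A set `S` is absorbing if `P(x,S) = 1` for all `x ∈ S`. -/
def Absorbing (P : Kernel X X) (S : Set X) : Prop := ∀ x ∈ S, P x S = 1

/-- A set is simple if its only absorbing measurable subset is empty. -/
def Simple (P : Kernel X X) (A : Set X) : Prop :=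
  ∀ S ⊆ A, MeasurableSet S → Absorbing P S → S = ∅


theorem measurable_transOp (P : Kernel X X) {f : X → ℝ} (hf : Measurable f) :
    Measurable (transOp P f) :=
  hf.stronglyMeasurable.integral_kernel.measurable

theorem measurable_uN (P : Kernel X X) {A : Set X} (hA : MeasurableSet A) (n : ℕ) :
    Measurable (uN P A n) := by
  induction n with
  | zero => exact measurable_one.indicator hA
  | succ n ih => exact (measurable_transOp P ih).indicator hA

theorem uN_nonneg (P : Kernel X X) (A : Set X) (n : ℕ) (x : X) : 0 ≤ uN P A n x := by
  induction n generalizing x with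
  | zero => exact Set.indicator_nonneg (fun _ _ => zero_le_one) x
  | succ n ih => exact Set.indicator_nonneg (fun _ _ => integral_nonneg ih) x

theorem uN_le_one (P : Kernel X X) [IsMarkovKernel P] {A : Set X} (n : ℕ) (x : X) :
    uN P A n x ≤ 1 := by
  induction n generalizing x with
  | zero => exact Set.indicator_le_self' (fun _ _ => zero_le_one) x
  | succ n ih =>
    refine Set.indicator_le' (g := fun _ => (1 : ℝ)) (fun y _ => ?_) (fun _ _ => zero_le_one) x
    have h := integral_mono_of_nonneg (μ := P y) (.of_forall (uN_nonneg P A n))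
      (integrable_const (1 : ℝ)) (.of_forall ih)
    simpa [transOp] using h

theorem integrable_uN (P : Kernel X X) [IsMarkovKernel P] {A : Set X} (hA : MeasurableSet A)
    (n : ℕ) (x : X) : Integrable (uN P A n) (P x) :=
  .of_bound (measurable_uN P hA n).aestronglyMeasurable 1 <| .of_forall fun y => by
    rw [Real.norm_of_nonneg (uN_nonneg P A n y)]
    exact uN_le_one P n y

theorem one_sub_div_le_uN (P : Kernel X X) [IsMarkovKernel P] {g : X → ℝ}
    (hgm : Measurable g) (hgb : BddFun g) (hg0 : ∀ x, 0 ≤ g x) {δ : ℝ} (hδ : 0 < δ)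
    (hexc : ∀ x, g x < δ → transOp P g x ≤ g x) (n : ℕ) (x : X) :
    1 - g x / δ ≤ uN P {y | g y < δ} n x := by
  have hA : MeasurableSet {y | g y < δ} := measurableSet_lt hgm measurable_const
  induction n generalizing x with
  | zero =>
    by_cases hx : g x < δ
    · simpa [uN, hx] using div_nonneg (hg0 x) hδ.le
    · simpa [uN, hx] using (one_le_div hδ).2 (not_lt.1 hx)
  | succ n ih =>
    by_cases hx : g x < δ
    · obtain ⟨C, hC⟩ := hgb
      have hgi : Integrable g (P x) := .of_bound hgm.aestronglyMeasurable C (.of_forall hC)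
      have hu : uN P {y | g y < δ} (n + 1) x = ∫ y, uN P {y | g y < δ} n y ∂(P x) := by
        simp [uN, invOp, transOp, hx]
      calc 1 - g x / δ ≤ 1 - transOp P g x / δ := by gcongr; exact hexc x hx
        _ = ∫ y, (1 - g y / δ) ∂(P x) := by
          rw [integral_sub (integrable_const _) (hgi.div_const δ), integral_div]
          simp [transOp]
        _ ≤ ∫ y, uN P {y | g y < δ} n y ∂(P x) :=
          integral_mono ((integrable_const _).sub (hgi.div_const δ)) (integrable_uN P hA n x) ih
        _ = _ := hu.symm
    · simpa [uN, invOp, hx] using (one_le_div hδ).2 (not_lt.1 hx)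

/-- local Doob inequality: if `g` is bounded, measurable, nonnegative, `δ > 0`
and `(Pg)(x) ≤ g(x)` on `{g < δ}`, then `u(x;{g < δ}) ≥ 1 − g(x)/δ` for every `x`. -/
theorem stmt11 (P : Kernel X X) [IsMarkovKernel P] (g : X → ℝ)
    (hgm : Measurable g) (hgb : BddFun g) (hg0 : ∀ x, 0 ≤ g x)
    (δ : ℝ) (hδ : 0 < δ)
    (hexc : ∀ x, g x < δ → transOp P g x ≤ g x) :
    ∀ x : X, 1 - g x / δ ≤ uFun P {y | g y < δ} x := by
  exact fun x => le_ciInf fun n => one_sub_div_le_uN P hgm hgb hg0 hδ hexc n x
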